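/- arXiv:1803.01740 — 2 statements merged into one kernel-verified Lean document; each statement's English description precedes it below -/
import Mathlib

section
/- Let G be a finite group and U an R[G]-module that is a finite direct sum of modules U_i, each of which is relatively H_i-projective for proper subgroups H_i < G. If γ : Y → U is a surjective R[G]-module homomorphism that splits as an R[H]-module map for every proper subgroup H < G, then γ splits as an R[G]-module homomorphism. -/
section Transfer

variable {R G U Y : Type*} [CommRing R] [Group G]
  [AddCommGroup U] [Module R U] [AddCommGroup Y] [Module R Y]
  [DistribMulAction G U] [DistribMulAction G Y]

/-- The conjugate of an `H`-equivariant map by `a` depends only on the coset `a H`. -/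
theorem out_smul_map_out_inv_smul {H : Subgroup G} {f : U →ₗ[R] Y}
    (hf : ∀ h ∈ H, ∀ x : U, f (h • x) = h • f x) (a : G) (x : U) :
    (a : G ⧸ H).out • f ((a : G ⧸ H).out⁻¹ • x) = a • f (a⁻¹ • x) := by
  obtain ⟨h, hh⟩ := QuotientGroup.mk_out_eq_mul H a
  rw [hh, mul_inv_rev, mul_smul, mul_smul, hf _ (H.inv_mem h.2), smul_inv_smul]

variable [SMulCommClass G R U] [SMulCommClass G R Y]

/-- The relative transfer of a linear map `f`, the sum of the conjugates of `f` over chosen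
representatives of the left cosets of `H`. -/
noncomputable def relativeTransfer (H : Subgroup G) [Fintype (G ⧸ H)] (f : U →ₗ[R] Y) :
    U →ₗ[R] Y :=
  ∑ q : G ⧸ H, DistribSMul.toLinearMap R Y q.out ∘ₗ f ∘ₗ
    DistribSMul.toLinearMap R U q.out⁻¹

theorem relativeTransfer_apply (H : Subgroup G) [Fintype (G ⧸ H)] (f : U →ₗ[R] Y) (x : U) :
    relativeTransfer H f x = ∑ q : G ⧸ H, q.out • f (q.out⁻¹ • x) := by
  simp [relativeTransfer]

/-- The relative transfer of an `H`-equivariant map is `G`-equivariant. -/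
theorem relativeTransfer_smul {H : Subgroup G} [Fintype (G ⧸ H)] {f : U →ₗ[R] Y}
    (hf : ∀ h ∈ H, ∀ x : U, f (h • x) = h • f x) (g : G) (x : U) :
    relativeTransfer H f (g • x) = g • relativeTransfer H f x := by
  rw [relativeTransfer_apply, relativeTransfer_apply, Finset.smul_sum,
    ← Equiv.sum_comp (MulAction.toPerm g)]
  refine Finset.sum_congr rfl fun q _ => ?_
  have hq : MulAction.toPerm g q = ((g * q.out : G) : G ⧸ H) := by
    conv_lhs => rw [← q.out_eq']
    rfl
  rw [hq, out_smul_map_out_inv_smul hf, mul_inv_rev, mul_smul, mul_smul, inv_smul_smul]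

end Transfer

/-- Let `G` be a finite group and `U` an `R[G]`-module that is a finite
direct sum of submodules `W i`, each of which is relatively `H i`-projective for a proper
subgroup `H i < G` (the identity of `W i` is a relative transfer `Tr_{H i}^G (α i)` of an
`R[H i]`-equivariant endomorphism).  If `γ : Y → U` is a surjective `R[G]`-module
homomorphism that splits as an `R[H]`-module map for every proper subgroup `H < G`, then
`γ` splits as an `R[G]`-module homomorphism. -/
theorem stmt_4 (R : Type*) [CommRing R] (G : Type*) [Group G] [Finite G]
    (U Y : Type*) [AddCommGroup U] [Module R U] [AddCommGroup Y] [Module R Y]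
    [DistribMulAction G U] [SMulCommClass G R U]
    [DistribMulAction G Y] [SMulCommClass G R Y]
    (ι : Type*) [Fintype ι] [DecidableEq ι]
    (W : ι → Submodule R U) (hinternal : DirectSum.IsInternal W)
    (hstable : ∀ (i : ι) (g : G), ∀ x ∈ W i, g • x ∈ W i)
    (H : ι → Subgroup G) (hproper : ∀ i, H i ≠ ⊤)
    (α : ι → (U →ₗ[R] U))
    (hα : ∀ i, (∀ h ∈ H i, ∀ x : U, α i (h • x) = h • α i x) ∧
      (∀ x ∈ W i, α i x ∈ W i) ∧
      (∀ x ∈ W i, ∑ᶠ q : G ⧸ H i, (Quotient.out q) • α i ((Quotient.out q)⁻¹ • x) = x))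
    (γ : Y →ₗ[R] U) (hγequiv : ∀ (g : G) (y : Y), γ (g • y) = g • γ y)
    (hγsurj : Function.Surjective γ)
    (hsplit : ∀ K : Subgroup G, K ≠ ⊤ →
      ∃ s : U →ₗ[R] Y, (∀ h ∈ K, ∀ x : U, s (h • x) = h • s x) ∧ ∀ x : U, γ (s x) = x) :
    ∃ s : U →ₗ[R] Y, (∀ (g : G) (x : U), s (g • x) = g • s x) ∧ ∀ x : U, γ (s x) = x := by
  classical
  have hlocal : ∀ i, ∃ t : U →ₗ[R] Y, (∀ (g : G) (x : U), t (g • x) = g • t x) ∧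
      ∀ x ∈ W i, γ (t x) = x := by
    intro i
    obtain ⟨hαequiv, -, hαsum⟩ := hα i
    obtain ⟨s, hs, hγs⟩ := hsplit (H i) (hproper i)
    have : Fintype (G ⧸ H i) := Fintype.ofFinite _
    refine ⟨relativeTransfer (H i) (s ∘ₗ α i), relativeTransfer_smul fun h hh x => ?_,
      fun x hx => ?_⟩
    · simp only [LinearMap.comp_apply, hαequiv h hh, hs h hh]
    · have hsum := hαsum x hx
      rw [finsum_eq_sum_of_fintype] at hsum
      simpa only [relativeTransfer_apply, map_sum, hγequiv, LinearMap.comp_apply, hγs] using hsum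
  choose t ht hγt using hlocal
  let e := LinearEquiv.ofBijective (DirectSum.coeLinearMap W) hinternal
  let s : U →ₗ[R] Y := DirectSum.toModule R ι Y (fun i => t i ∘ₗ (W i).subtype) ∘ₗ e.symm
  have hs : ∀ i, ∀ x ∈ W i, s x = t i x := by
    intro i x hx
    have hx' : e.symm x = DirectSum.lof R ι (fun i => W i) i ⟨x, hx⟩ := by
      rw [LinearEquiv.symm_apply_eq]
      exact (DirectSum.coeLinearMap_lof W i ⟨x, hx⟩).symm
    simp [s, hx']
  have hmem : ∀ x : U, x ∈ ⨆ i, W i := fun x => by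
    rw [hinternal.submodule_iSup_eq_top]
    trivial
  refine ⟨s, fun g x => ?_, fun x => ?_⟩
  · induction hmem x using Submodule.iSup_induction' with
    | mem i x hx => rw [hs i _ (hstable i g x hx), hs i x hx, ht]
    | zero => simp
    | add x y _ _ hx hy => rw [smul_add, map_add, map_add, smul_add, hx, hy]
  · induction hmem x using Submodule.iSup_induction' with
    | mem i x hx => rw [hs i x hx, hγt i x hx]
    | zero => simp
    | add x y _ _ hx hy => rw [map_add, map_add, hx, hy]
end

section
/- Let G be a finite p-group, R a commutative local ring with residue field of characteristic p, and H ≤ G. Then the permutation module R[G/H] has local endomorphism ring; in particular R[G/H] is an indecomposable R[G]-module. -/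
open MonoidAlgebra IsLocalRing

/-- A `p`-torsion submodule stable under a finite `p`-group contains a nonzero fixed vector. -/
theorem IsPGroup.exists_fixed_of_nsmul_eq_zero {p : ℕ} [Fact p.Prime] {R G A : Type*}
    [CommRing R] [Group G] [Finite G] (hG : IsPGroup p G) [AddCommGroup A] [Module R A]
    (ρ : Representation R G A) (W : Submodule R A) (hW : ∀ g, ∀ a ∈ W, ρ g a ∈ W)
    (hp : ∀ a ∈ W, p • a = 0) (hne : W ≠ ⊥) :
    ∃ a ∈ W, a ≠ 0 ∧ ∀ g, ρ g a = a := by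
  obtain ⟨a, haW, ha⟩ := W.ne_bot_iff.1 hne
  let S : AddSubgroup A := AddSubgroup.closure (Set.range fun g ↦ ρ g a)
  have hSW : S ≤ W.toAddSubgroup := by
    rw [AddSubgroup.closure_le]
    rintro _ ⟨g, rfl⟩
    exact hW g a haW
  have haS : a ∈ S := AddSubgroup.subset_closure ⟨1, by simp⟩
  have hpS : ∀ s : S, p • s = 0 := fun s ↦ Subtype.ext (hp s (hSW s.2))
  have : AddGroup.FG S := (AddGroup.fg_iff_addSubgroup_fg S).2
    ((AddSubgroup.fg_iff S).2 ⟨_, rfl, Set.finite_range _⟩)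
  have : Finite S := AddCommGroup.finite_of_fg_isAddTorsion S fun s ↦
    isOfFinAddOrder_iff_nsmul_eq_zero.2 ⟨p, (Fact.out : p.Prime).pos, hpS s⟩
  have hstable : ∀ g, ∀ s ∈ S, ρ g s ∈ S := by
    intro g s hs
    have : S ≤ S.comap (ρ g).toAddMonoidHom := by
      rw [AddSubgroup.closure_le]
      rintro _ ⟨h, rfl⟩
      exact AddSubgroup.subset_closure ⟨g * h, by simp⟩
    exact this hs
  let _ : MulAction G S :=
    { smul g s := ⟨ρ g s, hstable g s s.2⟩
      one_smul s := Subtype.ext (by change ρ 1 (s : A) = s; simp)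
      mul_smul g h s := Subtype.ext (by change ρ (g * h) (s : A) = ρ g (ρ h s); simp) }
  have hcard : p ∣ Nat.card S := by
    have hord : addOrderOf (⟨a, haS⟩ : S) = p :=
      addOrderOf_eq_prime (hpS _) fun h ↦ ha (congrArg Subtype.val h)
    exact hord ▸ addOrderOf_dvd_natCard _
  obtain ⟨b, hb, hb0⟩ := hG.exists_fixed_point_of_prime_dvd_card_of_fixed_point S hcard
    (a := 0) fun g ↦ Subtype.ext (map_zero (ρ g))
  exact ⟨b, hSW b.2, fun h ↦ hb0 (Subtype.ext h.symm), fun g ↦ congrArg Subtype.val (hb g)⟩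

/-- A proper submodule of a finite module over a local ring is killed by a nonzero functional
to the residue field. -/
theorem IsLocalRing.exists_linearMap_residueField_ne_zero {R M : Type*} [CommRing R]
    [IsLocalRing R] [AddCommGroup M] [Module R M] [Module.Finite R M] {N : Submodule R M}
    (hN : N ≠ ⊤) : ∃ l : M →ₗ[R] ResidueField R, l ≠ 0 ∧ ∀ x ∈ N, l x = 0 := by
  obtain ⟨L, hL, hNL⟩ := (eq_top_or_exists_le_coatom N).resolve_left hN
  obtain ⟨I, hI, ⟨e⟩⟩ := isSimpleModule_iff_quot_maximal.1 (isSimpleModule_iff_isCoatom.2 hL)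
  obtain rfl := eq_maximalIdeal hI
  refine ⟨e.toLinearMap ∘ₗ L.mkQ, fun h ↦ hL.1 (eq_top_iff.2 fun x _ ↦ ?_), fun x hx ↦ ?_⟩
  · rw [← Submodule.Quotient.mk_eq_zero L, ← e.map_eq_zero_iff]
    exact LinearMap.congr_fun h x
  · exact e.map_eq_zero_iff.2 ((Submodule.Quotient.mk_eq_zero L).2 (hNL hx))

namespace Representation

variable {R : Type*} [CommRing R] {G : Type*} [Group G] {X : Type*} [MulAction G X]

theorem end_map_ofMulAction
    (f : Module.End R[G] (ofMulAction R G X).asModule) (g : G) (v : R[X]) :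
    (f (ofMulAction R G X g v : R[X]) : R[X]) = ofMulAction R G X g (f v : R[X]) := by
  have h := asModuleEquiv_symm_map_rho (ofMulAction R G X) g
  exact (congrArg f (h v)).trans ((map_smul f _ _).trans (h (f v)).symm)

variable [IsLocalRing R]

variable (R X) in
/-- The augmentation of a permutation module, reduced to the residue field. -/
noncomputable def residueAugmentation : R[X] →ₗ[R] ResidueField R :=
  Finsupp.lsum R (fun _ ↦ Algebra.linearMap R (ResidueField R)) ∘ₗ
    (coeffLinearEquiv R).toLinearMap

@[simp]
theorem residueAugmentation_single (x : X) (r : R) :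
    residueAugmentation R X (single x r) = residue R r := by
  simp [residueAugmentation]

theorem residueAugmentation_ofMulAction (g : G) (v : R[X]) :
    residueAugmentation R X (ofMulAction R G X g v) = residueAugmentation R X v := by
  have : residueAugmentation R X ∘ₗ ofMulAction R G X g = residueAugmentation R X := by
    ext; simp
  exact LinearMap.congr_fun this v

theorem eq_mul_residueAugmentation [MulAction.IsPretransitive G X]
    (l : R[X] →ₗ[R] ResidueField R) (hl : ∀ (g : G) v, l (ofMulAction R G X g v) = l v)
    (x : X) (v : R[X]) : l v = l (single x 1) * residueAugmentation R X v := by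
  have : l = LinearMap.mulLeft R (l (single x 1)) ∘ₗ residueAugmentation R X := by
    ext y
    obtain ⟨g, rfl⟩ := MulAction.exists_smul_eq G x y
    simpa using hl g (single x 1)
  exact LinearMap.congr_fun this v

theorem surjective_of_residueAugmentation_ne_zero {p : ℕ} [Fact p.Prime]
    [CharP (ResidueField R) p] [Finite G] (hG : IsPGroup p G) [Finite X]
    [MulAction.IsPretransitive G X] (f : R[X] →ₗ[R] R[X])
    (hf : ∀ (g : G) v, f (ofMulAction R G X g v) = ofMulAction R G X g (f v)) (x : X)
    (hx : residueAugmentation R X (f (single x 1)) ≠ 0) : Function.Surjective f := by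
  rw [← LinearMap.range_eq_top]
  by_contra hr
  have : Module.Finite R R[X] := Module.Finite.equiv (coeffLinearEquiv R).symm
  obtain ⟨l, hl0, hl⟩ := exists_linearMap_residueField_ne_zero hr
  obtain ⟨m, hm, hm0, hmG⟩ := hG.exists_fixed_of_nsmul_eq_zero
    (linHom (ofMulAction R G X) (trivial R G (ResidueField R)))
    (LinearMap.ker (LinearMap.lcomp R (ResidueField R) f))
    (fun g a ha ↦ by
      refine LinearMap.ext fun v ↦ ?_
      have h : a (f (ofMulAction R G X g⁻¹ v)) = 0 :=
        LinearMap.congr_fun (LinearMap.mem_ker.1 ha) _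
      simpa [hf] using h)
    (fun a _ ↦ LinearMap.ext fun v ↦ by simp)
    ((Submodule.ne_bot_iff _).2 ⟨l, LinearMap.ext fun v ↦ hl _ ⟨v, rfl⟩, hl0⟩)
  have hinv : ∀ (g : G) v, m (ofMulAction R G X g v) = m v := fun g v ↦ by
    simpa using LinearMap.congr_fun (hmG g⁻¹) v
  have hkill : m (f (single x 1)) = 0 := LinearMap.congr_fun (LinearMap.mem_ker.1 hm) _
  rw [eq_mul_residueAugmentation m hinv x, mul_eq_zero, or_iff_left hx] at hkill
  exact hm0 (LinearMap.ext fun v ↦ by simp [eq_mul_residueAugmentation m hinv x v, hkill])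

variable (R) in
/-- The action of an endomorphism of a transitive permutation module on the quotient by the
kernel of the augmentation to the residue field. -/
noncomputable def endResidue [MulAction.IsPretransitive G X] (x : X) :
    Module.End R[G] (ofMulAction R G X).asModule →+* ResidueField R where
  toFun f := residueAugmentation R X (f (single x 1 : R[X]))
  map_one' := by
    change residueAugmentation R X (single x 1) = 1
    simp
  map_mul' f f' := by
    change (residueAugmentation R X ∘ₗ f.restrictScalars R : R[X] →ₗ[R] _)
      (f' (single x 1 : R[X])) = _
    refine eq_mul_residueAugmentation (G := G) _ (fun g v ↦ ?_) x _
    exact (congrArg _ (end_map_ofMulAction f g v)).trans (residueAugmentation_ofMulAction g _)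
  map_zero' := map_zero (residueAugmentation R X)
  map_add' f f' := map_add (residueAugmentation R X) _ _

theorem isLocalHom_endResidue {p : ℕ} [Fact p.Prime]
    [CharP (ResidueField R) p] [Finite G] (hG : IsPGroup p G) [Finite X]
    [MulAction.IsPretransitive G X] (x : X) : IsLocalHom (endResidue R (G := G) x) where
  map_nonunit f hf := by
    have hs := surjective_of_residueAugmentation_ne_zero hG
      (f.restrictScalars R : R[X] →ₗ[R] R[X]) (end_map_ofMulAction f) x hf.ne_zero
    have : Module.Finite R R[X] := Module.Finite.equiv (coeffLinearEquiv R).symm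
    exact (Module.End.isUnit_iff f).2
      (OrzechProperty.bijective_of_surjective_endomorphism (R := R) (M := R[X]) _ hs)

end Representation

/-- A module with local endomorphism ring has no nontrivial direct sum decomposition. -/
theorem Submodule.eq_bot_or_eq_bot_of_isCompl {A M : Type*} [Ring A] [AddCommGroup M]
    [Module A M] [IsLocalRing (Module.End A M)] {W W' : Submodule A M} (h : IsCompl W W') :
    W = ⊥ ∨ W' = ⊥ := by
  have key {U U' : Submodule A M} (hU : IsCompl U U') (hu : IsUnit (U.projection U' hU)) :
      U' = ⊥ := by
    rw [← ker_projection hU]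
    exact LinearMap.ker_eq_bot.2 ((Module.End.isUnit_iff _).1 hu).1
  exact (IsLocalRing.isUnit_or_isUnit_of_add_one (projection_add_projection_eq_id h)).symm.imp
    (key h.symm) (key h)

/-- Let `G` be a finite `p`-group, `R` a commutative local ring with
residue field of characteristic `p`, and `H ≤ G`.  Then the permutation module `R[G/H]`
has local endomorphism ring; in particular `R[G/H]` is an indecomposable `R[G]`-module. -/
theorem stmt_6 (p : ℕ) [Fact p.Prime] (R : Type) [CommRing R] [IsLocalRing R]
    [CharP (IsLocalRing.ResidueField R) p]
    (G : Type) [Group G] [Finite G] (hG : IsPGroup p G) (H : Subgroup G) :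
    IsLocalRing
      (Module.End (MonoidAlgebra R G) (Representation.ofMulAction R G (G ⧸ H)).asModule) ∧
    ∀ W W' : Submodule (MonoidAlgebra R G)
        (Representation.ofMulAction R G (G ⧸ H)).asModule,
      IsCompl W W' → W = ⊥ ∨ W' = ⊥ := by
  have := Representation.isLocalHom_endResidue (R := R) hG (QuotientGroup.mk 1 : G ⧸ H)
  have := (Representation.endResidue R (G := G) (QuotientGroup.mk 1 : G ⧸ H)).domain_isLocalRing
  exact ⟨this, fun _ _ ↦ Submodule.eq_bot_or_eq_bot_of_isCompl⟩
end
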